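/- arXiv:1505.00196 — 3 statements merged into one kernel-verified Lean document; each statement's English description precedes it below -/
import Mathlib

section
/- Let γ ∈ ℝ, B ≥ 0, and let ν be a Lévy measure on ℝ (i.e. ν({0}) = 0 and ∫_ℝ (1 ∧ x²) ν(dx) < ∞). With τ(x) := x/(1 ∨ |x|), H(r) := |γ r + ∫_ℝ (τ(xr) − r τ(x)) ν(dx)|, and Ψ(r) := sup_{|c| ≤ 1} H(cr) + B r² + ∫_ℝ (1 ∧ |rx|²) ν(dx), let φ_α(s) := e^{−s} s^α for s > 0 and φ_α(s) := 0 for s ≤ 0, where α > −1. Then ∫_ℝ Ψ(φ_α(s)) ds < ∞ if and only if both of the following hold: (1) ∫_{|x|>1} log|x| ν(dx) < ∞; and (2) one of: (a) α > −1/2; or (b) α = −1/2, B = 0 and ∫_{|x|≤1} x² |log|x|| ν(dx) < ∞; or (c) α ∈ (−1, −1/2), B = 0 and ∫_{|x|≤1} |x|^{−1/α} ν(dx) < ∞. -/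
open MeasureTheory Set Real
open scoped ENNReal

theorem setLIntegral_ofReal_le_of_integral_le {β : Type*} [MeasurableSpace β] {μ : Measure β}
    {s : Set β} {f g : β → ℝ} {C : ℝ} (hs : MeasurableSet s) (hfg : ∀ x ∈ s, f x ≤ g x)
    (hg : IntegrableOn g s μ) (hg0 : ∀ x ∈ s, 0 ≤ g x) (hC : ∫ x in s, g x ∂μ ≤ C) :
    ∫⁻ x in s, ENNReal.ofReal (f x) ∂μ ≤ ENNReal.ofReal C := by
  calc ∫⁻ x in s, ENNReal.ofReal (f x) ∂μ
      ≤ ∫⁻ x in s, ENNReal.ofReal (g x) ∂μ :=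
        setLIntegral_mono' hs fun x hx => ENNReal.ofReal_le_ofReal (hfg x hx)
    _ = ENNReal.ofReal (∫ x in s, g x ∂μ) :=
        (ofReal_integral_eq_lintegral_ofReal hg (ae_restrict_of_forall_mem hs hg0)).symm
    _ ≤ ENNReal.ofReal C := ENNReal.ofReal_le_ofReal hC

theorem le_setLIntegral_ofReal_of_le_integral {β : Type*} [MeasurableSpace β] {μ : Measure β}
    {s : Set β} {f g : β → ℝ} {C : ℝ} (hs : MeasurableSet s) (hfg : ∀ x ∈ s, g x ≤ f x)
    (hg : IntegrableOn g s μ) (hg0 : ∀ x ∈ s, 0 ≤ g x) (hC : C ≤ ∫ x in s, g x ∂μ) :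
    ENNReal.ofReal C ≤ ∫⁻ x in s, ENNReal.ofReal (f x) ∂μ := by
  calc ENNReal.ofReal C ≤ ENNReal.ofReal (∫ x in s, g x ∂μ) := ENNReal.ofReal_le_ofReal hC
    _ = ∫⁻ x in s, ENNReal.ofReal (g x) ∂μ :=
        ofReal_integral_eq_lintegral_ofReal hg (ae_restrict_of_forall_mem hs hg0)
    _ ≤ ∫⁻ x in s, ENNReal.ofReal (f x) ∂μ :=
        setLIntegral_mono' hs fun x hx => ENNReal.ofReal_le_ofReal (hfg x hx)

theorem setLIntegral_Ioi_le_add {a : ℝ} (ha : 0 ≤ a) (f : ℝ → ℝ≥0∞) :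
    ∫⁻ s in Ioi (0 : ℝ), f s ≤ (∫⁻ s in Ioc 0 a, f s) + ∫⁻ s in Ioi a, f s := by
  rw [← Ioc_union_Ioi_eq_Ioi ha]
  exact lintegral_union_le _ _ _

theorem rpow_le_mul_exp_half (α : ℝ) :
    ∃ C : ℝ, 0 < C ∧ ∀ s : ℝ, 1 ≤ s → s ^ α ≤ C * exp (s / 2) := by
  refine ⟨2 ^ ⌈α⌉₊ * (⌈α⌉₊.factorial : ℝ), by positivity, fun s hs => ?_⟩
  have h1 : s ^ α ≤ s ^ ⌈α⌉₊ := by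
    rw [← Real.rpow_natCast]
    exact Real.rpow_le_rpow_of_exponent_le hs (Nat.le_ceil α)
  have h2 := Real.pow_div_factorial_le_exp (s / 2) (by linarith) ⌈α⌉₊
  rw [div_le_iff₀ (by positivity), div_pow, div_le_iff₀ (by positivity)] at h2
  linarith

/-- The gamma kernel on the positive half-line. -/
noncomputable def gammaKernel (α s : ℝ) : ℝ := exp (-s) * s ^ α

theorem gammaKernel_nonneg {α s : ℝ} (hs : 0 ≤ s) : 0 ≤ gammaKernel α s :=
  mul_nonneg (exp_pos _).le (rpow_nonneg hs _)

theorem gammaKernel_le_rpow {α s : ℝ} (hs : 0 ≤ s) : gammaKernel α s ≤ s ^ α :=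
  mul_le_of_le_one_left (rpow_nonneg hs _) (exp_le_one_iff.2 (by linarith))

theorem le_gammaKernel {α s : ℝ} (hs : 0 ≤ s) (hs1 : s ≤ 1) :
    exp (-1) * s ^ α ≤ gammaKernel α s :=
  mul_le_mul_of_nonneg_right (exp_le_exp.2 (by linarith)) (rpow_nonneg hs _)

@[fun_prop]
theorem measurable_gammaKernel (α : ℝ) : Measurable (gammaKernel α) := by
  unfold gammaKernel
  fun_prop

theorem integrableOn_gammaKernel {α : ℝ} (hα : -1 < α) :
    IntegrableOn (gammaKernel α) (Ioi 0) := by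
  have := Real.GammaIntegral_convergent (s := α + 1) (by linarith)
  rwa [add_sub_cancel_right] at this

theorem integrableOn_gammaKernel_sq {α : ℝ} (hα : -(1 / 2) < α) :
    IntegrableOn (fun s => gammaKernel α s ^ 2) (Ioi 0) := by
  refine (integrableOn_gammaKernel (α := 2 * α) (by linarith)).mono'
    (by fun_prop) (ae_restrict_of_forall_mem measurableSet_Ioi fun s hs => ?_)
  have hs : 0 < s := hs
  rw [norm_of_nonneg (sq_nonneg _), gammaKernel, gammaKernel, mul_pow, ← rpow_natCast (s ^ α),
    ← rpow_mul hs.le, mul_comm α, ← exp_nat_mul]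
  exact mul_le_mul_of_nonneg_right (exp_le_exp.2 (by push_cast; linarith)) (rpow_nonneg hs.le _)

theorem lintegral_gammaKernel_sq_eq_top {α : ℝ} (hα : α ≤ -(1 / 2)) :
    ∫⁻ s in Ioi (0 : ℝ), ENNReal.ofReal (gammaKernel α s ^ 2) = ⊤ := by
  by_contra h
  have h1 : IntegrableOn (fun s => gammaKernel α s ^ 2) (Ioi 0) :=
    (lintegral_ofReal_ne_top_iff_integrable (by fun_prop)
      (Filter.Eventually.of_forall fun _ => sq_nonneg _)).1 h
  have h2 : IntegrableOn (fun s : ℝ => s ^ (2 * α)) (Ioo 0 1) := by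
    refine ((h1.mono_set Ioo_subset_Ioi_self).const_mul (exp 2)).mono' (by fun_prop)
      (ae_restrict_of_forall_mem measurableSet_Ioo fun s hs => ?_)
    have h3 : exp (-1) * s ^ α ≤ gammaKernel α s := le_gammaKernel hs.1.le hs.2.le
    have h4 := pow_le_pow_left₀ (mul_nonneg (exp_pos _).le (rpow_nonneg hs.1.le _)) h3 2
    rw [mul_pow, ← rpow_natCast (s ^ α), ← rpow_mul hs.1.le, mul_comm α, ← exp_nat_mul] at h4
    rw [norm_of_nonneg (rpow_nonneg hs.1.le _)]
    calc s ^ (2 * α) = exp 2 * (exp (-2) * s ^ (2 * α)) := by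
          rw [← mul_assoc, ← exp_add]; simp
      _ ≤ _ := by
          refine mul_le_mul_of_nonneg_left ?_ (exp_pos _).le
          simpa using h4
  rw [intervalIntegral.integrableOn_Ioo_rpow_iff one_pos] at h2
  linarith

/-- Large jumps contribute logarithmically, because of the exponential tail of the kernel. -/
theorem lintegral_min_one_gammaKernel_le_log (α : ℝ) :
    ∃ C : ℝ, 0 < C ∧ ∀ y : ℝ, 1 ≤ y →
      ∫⁻ s in Ioi (0 : ℝ), ENNReal.ofReal (min 1 (gammaKernel α s * y)) ≤
        ENNReal.ofReal (C * (1 + log y)) := by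
  obtain ⟨C, hC, hdecay⟩ := rpow_le_mul_exp_half α
  refine ⟨2 + 2 * C, by positivity, fun y hy => ?_⟩
  have hlog : 0 ≤ log y := log_nonneg hy
  have hy0 : 0 < y := by linarith
  refine (setLIntegral_Ioi_le_add (a := 1 + 2 * log y) (by linarith) _).trans ?_
  have h1 : ∫⁻ s in Ioc 0 (1 + 2 * log y), ENNReal.ofReal (min 1 (gammaKernel α s * y)) ≤
      ENNReal.ofReal (1 + 2 * log y) := by
    refine setLIntegral_ofReal_le_of_integral_le (g := fun _ => 1) measurableSet_Ioc
      (fun s _ => min_le_left _ _) (by simp) (by simp) ?_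
    simp; linarith
  have h2 : ∫⁻ s in Ioi (1 + 2 * log y), ENNReal.ofReal (min 1 (gammaKernel α s * y)) ≤
      ENNReal.ofReal (2 * C) := by
    refine setLIntegral_ofReal_le_of_integral_le (g := fun s => (C * y) * exp (-(1 / 2) * s))
      measurableSet_Ioi (fun s hs => ?_) ((integrableOn_exp_mul_Ioi (by norm_num) _).const_mul _)
      (fun s _ => by positivity) ?_
    · have hs1 : 1 ≤ s := by have : 1 + 2 * log y < s := hs; linarith
      refine (min_le_right _ _).trans ?_
      have : gammaKernel α s ≤ C * exp (-(1 / 2) * s) := by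
        calc gammaKernel α s ≤ exp (-s) * (C * exp (s / 2)) :=
              mul_le_mul_of_nonneg_left (hdecay s hs1) (exp_pos _).le
          _ = C * (exp (-s) * exp (s / 2)) := by ring
          _ = C * exp (-(1 / 2) * s) := by rw [← exp_add]; ring_nf
      nlinarith
    · rw [integral_const_mul, integral_exp_mul_Ioi (by norm_num)]
      have h3 : exp (-(1 / 2) * (1 + 2 * log y)) = exp (-(1 / 2)) * y⁻¹ := by
        rw [show -(1 / 2) * (1 + 2 * log y) = -(1 / 2) + -log y by ring, exp_add, exp_neg (log y),
          exp_log hy0]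
      have h4 : exp (-(1 / 2) : ℝ) ≤ 1 := exp_le_one_iff.2 (by norm_num)
      rw [h3]
      calc C * y * (-(exp (-(1 / 2)) * y⁻¹) / -(1 / 2)) = 2 * C * exp (-(1 / 2)) := by
            field_simp
        _ ≤ 2 * C := mul_le_of_le_one_right (by positivity) h4
  refine (add_le_add h1 h2).trans ?_
  rw [← ENNReal.ofReal_add (by positivity) (by positivity)]
  exact ENNReal.ofReal_le_ofReal (by nlinarith)

theorem log_le_lintegral_min_one_gammaKernel_sq {α : ℝ} (hα : -1 < α) {y : ℝ} (hy : 1 ≤ y) :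
    ENNReal.ofReal (log y / 2 - 1) ≤
      ∫⁻ s in Ioi (0 : ℝ), ENNReal.ofReal (min 1 ((gammaKernel α s * y) ^ 2)) := by
  refine le_trans ?_ (lintegral_mono_set (s := Ioc 1 (log y / 2))
    fun s hs => lt_trans one_pos hs.1)
  refine le_setLIntegral_ofReal_of_le_integral (g := fun _ => 1) measurableSet_Ioc
    (fun s hs => ?_) (by simp) (by simp) ?_
  · refine le_min le_rfl ?_
    have hs0 : 0 < s := by linarith [hs.1]
    have h1 : exp (-s) ≤ s ^ α := by
      rw [rpow_def_of_pos hs0]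
      refine exp_le_exp.2 ?_
      nlinarith [log_le_sub_one_of_pos hs0, log_nonneg hs.1.le]
    have h2 : exp (-log y) ≤ exp (-s) * exp (-s) := by
      rw [← exp_add]
      exact exp_le_exp.2 (by linarith [hs.2])
    have hy0 : 0 < y := by linarith
    have h3 : 1 ≤ gammaKernel α s * y := by
      rw [exp_neg, exp_log hy0] at h2
      calc (1 : ℝ) = y⁻¹ * y := by field_simp
        _ ≤ _ := by
          refine mul_le_mul_of_nonneg_right (h2.trans ?_) hy0.le
          exact mul_le_mul_of_nonneg_left h1 (exp_pos _).le
    exact one_le_pow₀ h3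
  · simp

theorem rpow_neg_one_div_rpow {α y : ℝ} (hα : α ≠ 0) (hy : 0 < y) :
    (y ^ (-(1 / α))) ^ α = y⁻¹ := by
  rw [← rpow_mul hy.le, neg_mul, one_div_mul_cancel hα, rpow_neg_one]

theorem rpow_mul_le_one_of_le {α y s : ℝ} (hα : α < 0) (hy : 0 < y)
    (hs : y ^ (-(1 / α)) ≤ s) : s ^ α * y ≤ 1 := by
  have h := rpow_le_rpow_of_nonpos (rpow_pos_of_pos hy _) hs hα.le
  rw [rpow_neg_one_div_rpow hα.ne hy] at h
  calc s ^ α * y ≤ y⁻¹ * y := mul_le_mul_of_nonneg_right h hy.le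
    _ = 1 := inv_mul_cancel₀ hy.ne'

theorem one_le_rpow_mul_of_le {α y s : ℝ} (hα : α < 0) (hy : 0 < y) (hs0 : 0 < s)
    (hs : s ≤ y ^ (-(1 / α))) : 1 ≤ s ^ α * y := by
  have h := rpow_le_rpow_of_nonpos hs0 hs hα.le
  rw [rpow_neg_one_div_rpow hα.ne hy] at h
  calc 1 = y⁻¹ * y := (inv_mul_cancel₀ hy.ne').symm
    _ ≤ s ^ α * y := mul_le_mul_of_nonneg_right h hy.le

theorem rpow_neg_one_div_le_one {α y : ℝ} (hα : α < 0) (hy : 0 < y) (hy1 : y ≤ 1) :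
    y ^ (-(1 / α)) ≤ 1 :=
  rpow_le_one hy.le hy1 (by rw [← one_div_neg_eq_neg_one_div]; exact one_div_nonneg.2 (by linarith))

theorem gammaKernel_mul_sq_le {α y s : ℝ} (hs : 0 ≤ s) :
    (gammaKernel α s * y) ^ 2 ≤ y ^ 2 * s ^ (2 * α) := by
  rw [mul_comm 2 α, rpow_mul hs, rpow_two, mul_pow, mul_comm]
  exact mul_le_mul_of_nonneg_left
    (pow_le_pow_left₀ (gammaKernel_nonneg hs) (gammaKernel_le_rpow hs) 2) (sq_nonneg _)

theorem lintegral_indicator_gammaKernel_le {α : ℝ} (hα : -1 < α) (hα0 : α < 0) {y : ℝ}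
    (hy : 0 < y) :
    ∫⁻ s in Ioi (0 : ℝ), ENNReal.ofReal
        (if 1 < gammaKernel α s * y then gammaKernel α s * y else 0) ≤
      ENNReal.ofReal (1 / (α + 1) * y ^ (-(1 / α))) := by
  set a := y ^ (-(1 / α)) with ha
  have ha0 : 0 < a := rpow_pos_of_pos hy _
  refine (setLIntegral_Ioi_le_add ha0.le _).trans ?_
  have h2 : ∫⁻ s in Ioi a, ENNReal.ofReal
      (if 1 < gammaKernel α s * y then gammaKernel α s * y else 0) ≤ ENNReal.ofReal 0 := by
    refine setLIntegral_ofReal_le_of_integral_le (g := fun _ => 0) measurableSet_Ioi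
      (fun s hs => ?_) (by simp) (by simp) (by simp)
    have hs : a < s := hs
    have hs0 : 0 < s := ha0.trans hs
    have h3 : gammaKernel α s * y ≤ 1 :=
      (mul_le_mul_of_nonneg_right (gammaKernel_le_rpow hs0.le) hy.le).trans
        (rpow_mul_le_one_of_le hα0 hy hs.le)
    rw [if_neg h3.not_gt]
  have h1 : ∫⁻ s in Ioc 0 a, ENNReal.ofReal
      (if 1 < gammaKernel α s * y then gammaKernel α s * y else 0) ≤
      ENNReal.ofReal (1 / (α + 1) * a) := by
    refine setLIntegral_ofReal_le_of_integral_le (g := fun s => s ^ α * y) measurableSet_Ioc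
      (fun s hs => ?_) ?_ (fun s hs => mul_nonneg (rpow_nonneg hs.1.le _) hy.le) ?_
    · have h3 := mul_le_mul_of_nonneg_right (gammaKernel_le_rpow (α := α) hs.1.le) hy.le
      split_ifs
      · exact h3
      · exact mul_nonneg (rpow_nonneg hs.1.le _) hy.le
    · rw [← intervalIntegrable_iff_integrableOn_Ioc_of_le ha0.le]
      exact (intervalIntegral.intervalIntegrable_rpow' hα).mul_const _
    · rw [← intervalIntegral.integral_of_le ha0.le, intervalIntegral.integral_mul_const,
        integral_rpow (Or.inl hα), zero_rpow (by linarith), rpow_add_one ha0.ne',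
        ha, rpow_neg_one_div_rpow hα0.ne hy]
      exact le_of_eq (by field_simp; simp)
  simpa using add_le_add h1 h2

theorem lintegral_min_one_gammaKernel_sq_le_rpow {α : ℝ} (hα : α < -(1 / 2)) {y : ℝ}
    (hy : 0 < y) :
    ∫⁻ s in Ioi (0 : ℝ), ENNReal.ofReal (min 1 ((gammaKernel α s * y) ^ 2)) ≤
      ENNReal.ofReal ((1 + 1 / (-(2 * α + 1))) * y ^ (-(1 / α))) := by
  have hα0 : α < 0 := by linarith
  have hc : 0 < -(2 * α + 1) := by linarith
  set a := y ^ (-(1 / α)) with ha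
  have ha0 : 0 < a := rpow_pos_of_pos hy _
  refine (setLIntegral_Ioi_le_add ha0.le _).trans ?_
  have h1 : ∫⁻ s in Ioc 0 a, ENNReal.ofReal (min 1 ((gammaKernel α s * y) ^ 2)) ≤
      ENNReal.ofReal a :=
    setLIntegral_ofReal_le_of_integral_le (g := fun _ => 1) measurableSet_Ioc
      (fun s _ => min_le_left _ _) (by simp) (by simp) (by simp [ha0.le])
  have h2 : ∫⁻ s in Ioi a, ENNReal.ofReal (min 1 ((gammaKernel α s * y) ^ 2)) ≤
      ENNReal.ofReal (1 / (-(2 * α + 1)) * a) := by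
    refine setLIntegral_ofReal_le_of_integral_le (g := fun s => y ^ 2 * s ^ (2 * α))
      measurableSet_Ioi
      (fun s hs => (min_le_right _ _).trans (gammaKernel_mul_sq_le (ha0.trans hs).le))
      ((integrableOn_Ioi_rpow_of_lt (by linarith) ha0).const_mul _)
      (fun s hs => mul_nonneg (sq_nonneg _) (rpow_nonneg (ha0.trans hs).le _)) ?_
    rw [integral_const_mul, integral_Ioi_rpow_of_lt (by linarith) ha0, rpow_add_one ha0.ne',
      mul_comm 2 α, rpow_mul ha0.le, rpow_two, ha, rpow_neg_one_div_rpow hα0.ne hy, ← ha]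
    refine le_of_eq ?_
    have h3 : α * 2 + 1 ≠ 0 := by linarith
    have h4 : -(α * 2 + 1) ≠ 0 := by linarith
    field_simp
  refine (add_le_add h1 h2).trans ?_
  rw [← ENNReal.ofReal_add (by positivity) (by positivity)]
  exact ENNReal.ofReal_le_ofReal (by linarith)

theorem lintegral_min_one_gammaKernel_sq_le_log {y : ℝ} (hy : 0 < y) (hy1 : y ≤ 1) :
    ∫⁻ s in Ioi (0 : ℝ), ENNReal.ofReal (min 1 ((gammaKernel (-(1 / 2)) s * y) ^ 2)) ≤
      ENNReal.ofReal (2 * y ^ 2 + 2 * (y ^ 2 * |log y|)) := by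
  have ha0 : 0 < y ^ 2 := by positivity
  have ha1 : y ^ 2 ≤ 1 := pow_le_one₀ hy.le hy1
  have hlog : log y ≤ 0 := log_nonpos hy.le hy1
  have hb : ∀ s : ℝ, 0 < s → (gammaKernel (-(1 / 2)) s * y) ^ 2 ≤ y ^ 2 * s⁻¹ := by
    intro s hs
    have := gammaKernel_mul_sq_le (α := -(1 / 2)) (y := y) hs.le
    rwa [show 2 * -(1 / 2) = (-1 : ℝ) by norm_num, rpow_neg_one] at this
  refine (setLIntegral_Ioi_le_add zero_le_one _).trans ?_
  rw [← Ioc_union_Ioc_eq_Ioc ha0.le ha1]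
  have h1 : ∫⁻ s in Ioc 0 (y ^ 2),
      ENNReal.ofReal (min 1 ((gammaKernel (-(1 / 2)) s * y) ^ 2)) ≤ ENNReal.ofReal (y ^ 2) :=
    setLIntegral_ofReal_le_of_integral_le (g := fun _ => 1) measurableSet_Ioc
      (fun s _ => min_le_left _ _) (by simp) (by simp) (by simp [ha0.le])
  have h2 : ∫⁻ s in Ioc (y ^ 2) 1,
      ENNReal.ofReal (min 1 ((gammaKernel (-(1 / 2)) s * y) ^ 2)) ≤
        ENNReal.ofReal (2 * (y ^ 2 * |log y|)) := by
    refine setLIntegral_ofReal_le_of_integral_le (g := fun s => y ^ 2 * s⁻¹) measurableSet_Ioc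
      (fun s hs => (min_le_right _ _).trans (hb s (ha0.trans hs.1))) ?_
      (fun s hs => mul_nonneg (sq_nonneg _) (inv_nonneg.2 (ha0.trans hs.1).le)) ?_
    · rw [← intervalIntegrable_iff_integrableOn_Ioc_of_le ha1]
      exact (intervalIntegrable_inv_iff.2
        (Or.inr (notMem_uIcc_of_lt ha0 one_pos))).const_mul _
    · rw [← intervalIntegral.integral_of_le ha1, intervalIntegral.integral_const_mul,
        integral_inv_of_pos ha0 one_pos, one_div, log_inv, log_pow, abs_of_nonpos hlog]
      exact le_of_eq (by push_cast; ring)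
  have h3 : ∫⁻ s in Ioi (1 : ℝ),
      ENNReal.ofReal (min 1 ((gammaKernel (-(1 / 2)) s * y) ^ 2)) ≤ ENNReal.ofReal (y ^ 2) := by
    refine setLIntegral_ofReal_le_of_integral_le (g := fun s => y ^ 2 * exp (-s))
      measurableSet_Ioi (fun s hs => (min_le_right _ _).trans ?_)
      ((integrableOn_exp_neg_Ioi 1).const_mul _) (fun s _ => by positivity) ?_
    · have hs : 1 < s := hs
      have h4 : gammaKernel (-(1 / 2)) s ≤ exp (-s) :=
        mul_le_of_le_one_right (exp_pos _).le (rpow_le_one_of_one_le_of_nonpos hs.le (by norm_num))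
      have h5 : exp (-s) ≤ 1 := exp_le_one_iff.2 (by linarith)
      have h6 : 0 ≤ gammaKernel (-(1 / 2)) s := gammaKernel_nonneg (by linarith)
      rw [mul_pow, mul_comm]
      exact mul_le_mul_of_nonneg_left (by nlinarith) ha0.le
    · rw [integral_const_mul, integral_exp_neg_Ioi]
      exact mul_le_of_le_one_right ha0.le (exp_le_one_iff.2 (by norm_num))
  refine (add_le_add ((lintegral_union_le _ _ _).trans (add_le_add h1 h2)) h3).trans ?_
  rw [← ENNReal.ofReal_add (by positivity) (by positivity),
    ← ENNReal.ofReal_add (by positivity) (by positivity)]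
  exact ENNReal.ofReal_le_ofReal (by linarith)

theorem rpow_le_lintegral_min_one_gammaKernel_sq {α : ℝ} (hα : α < 0) {y : ℝ}
    (hy : 0 < y) (hy1 : y ≤ 1) :
    ENNReal.ofReal (exp (-1) ^ 2 * y ^ (-(1 / α))) ≤
      ∫⁻ s in Ioi (0 : ℝ), ENNReal.ofReal (min 1 ((gammaKernel α s * y) ^ 2)) := by
  have ha1 := rpow_neg_one_div_le_one hα hy hy1
  refine le_trans ?_ (lintegral_mono_set (s := Ioc 0 (y ^ (-(1 / α)))) Ioc_subset_Ioi_self)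
  refine le_setLIntegral_ofReal_of_le_integral (g := fun _ => exp (-1) ^ 2) measurableSet_Ioc
    (fun s hs => le_min ?_ ?_) (by simp) (fun _ _ => by positivity) ?_
  · exact pow_le_one₀ (exp_pos _).le (exp_le_one_iff.2 (by norm_num))
  · refine pow_le_pow_left₀ (exp_pos _).le ?_ 2
    have h1 := one_le_rpow_mul_of_le hα hy hs.1 hs.2
    have h2 := le_gammaKernel (α := α) hs.1.le (hs.2.trans ha1)
    calc exp (-1) ≤ exp (-1) * (s ^ α * y) := le_mul_of_one_le_right (exp_pos _).le h1
      _ = exp (-1) * s ^ α * y := by ring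
      _ ≤ _ := mul_le_mul_of_nonneg_right h2 hy.le
  · simp [rpow_nonneg hy.le, mul_comm]

theorem log_le_lintegral_min_one_gammaKernel_neg_half_sq {y : ℝ} (hy : 0 < y) (hy1 : y ≤ 1) :
    ENNReal.ofReal (exp (-1) ^ 2 * (y ^ 2 * |log y|)) ≤
      ∫⁻ s in Ioi (0 : ℝ), ENNReal.ofReal (min 1 ((gammaKernel (-(1 / 2)) s * y) ^ 2)) := by
  have ha0 : 0 < y ^ 2 := by positivity
  have ha1 : y ^ 2 ≤ 1 := pow_le_one₀ hy.le hy1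
  have hlog : log y ≤ 0 := log_nonpos hy.le hy1
  refine le_trans ?_ (lintegral_mono_set (s := Ioc (y ^ 2) 1) fun s hs => ha0.trans hs.1)
  refine le_setLIntegral_ofReal_of_le_integral
    (g := fun s => exp (-1) ^ 2 * y ^ 2 * s⁻¹) measurableSet_Ioc
    (fun s hs => le_min ?_ ?_) ?_ (fun s hs => mul_nonneg (by positivity)
      (inv_nonneg.2 (ha0.trans hs.1).le)) ?_
  · have hs0 : 0 < s := ha0.trans hs.1
    have h1 : exp (-1 : ℝ) ^ 2 ≤ 1 :=
      pow_le_one₀ (exp_pos _).le (exp_le_one_iff.2 (by norm_num))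
    have h2 : y ^ 2 * s⁻¹ ≤ 1 := by
      rw [← div_eq_mul_inv, div_le_one hs0]
      exact hs.1.le
    rw [mul_assoc]
    exact mul_le_one₀ h1 (by positivity) h2
  · have hs0 : 0 < s := ha0.trans hs.1
    have h2 := le_gammaKernel (α := -(1 / 2)) hs0.le hs.2
    have h3 : (s ^ (-(1 / 2) : ℝ)) ^ 2 = s⁻¹ := by
      rw [← rpow_natCast, ← rpow_mul hs0.le, ← rpow_neg_one]
      norm_num
    calc exp (-1) ^ 2 * y ^ 2 * s⁻¹ = (exp (-1) * s ^ (-(1 / 2) : ℝ) * y) ^ 2 := by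
          rw [mul_pow, mul_pow, h3]; ring
      _ ≤ _ := pow_le_pow_left₀ (by positivity) (mul_le_mul_of_nonneg_right h2 hy.le) 2
  · rw [← intervalIntegrable_iff_integrableOn_Ioc_of_le ha1]
    exact (intervalIntegrable_inv_iff.2
      (Or.inr (notMem_uIcc_of_lt ha0 one_pos))).const_mul _
  · rw [← intervalIntegral.integral_of_le ha1, intervalIntegral.integral_const_mul,
      integral_inv_of_pos ha0 one_pos, one_div, log_inv, log_pow, abs_of_nonpos hlog]
    push_cast
    have : 0 ≤ exp (-1) ^ 2 * y ^ 2 * -log y := mul_nonneg (by positivity) (by linarith)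
    linarith

section LevyMeasure

variable {ν : Measure ℝ}

theorem sFinite_of_levy (hν_zero : ν {0} = 0)
    (hν_levy : ∫⁻ x, ENNReal.ofReal (min 1 (x ^ 2)) ∂ν < ⊤) : SFinite ν := by
  have hfin := isFiniteMeasure_withDensity hν_levy.ne
  rw [← withDensity_inv_same (μ := ν) (f := fun x => ENNReal.ofReal (min 1 (x ^ 2)))
    (by fun_prop) ?_ (by simp)]
  · infer_instance
  · have h0 : ∀ᵐ x ∂ν, x ≠ 0 := by simpa [ae_iff] using hν_zero
    filter_upwards [h0] with x hx
    have : 0 < min 1 (x ^ 2) := lt_min one_pos (by positivity)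
    simpa using hx

theorem measurableSet_abs_le_one : MeasurableSet {x : ℝ | |x| ≤ 1} :=
  measurableSet_le (by fun_prop) (by fun_prop)

theorem measurableSet_one_lt_abs : MeasurableSet {x : ℝ | 1 < |x|} :=
  measurableSet_lt (by fun_prop) (by fun_prop)

theorem levy_measure_one_lt_abs_lt_top
    (hν_levy : ∫⁻ x, ENNReal.ofReal (min 1 (x ^ 2)) ∂ν < ⊤) : ν {x : ℝ | 1 < |x|} < ⊤ := by
  refine lt_of_le_of_lt ?_ hν_levy
  rw [← setLIntegral_one]
  refine le_trans (setLIntegral_mono' measurableSet_one_lt_abs fun x hx => ?_)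
    (setLIntegral_le_lintegral {x : ℝ | 1 < |x|} _)
  have hx : 1 < |x| := hx
  rw [min_eq_left (by rw [← sq_abs]; exact one_le_pow₀ hx.le), ENNReal.ofReal_one]

theorem levy_setLIntegral_sq_lt_top
    (hν_levy : ∫⁻ x, ENNReal.ofReal (min 1 (x ^ 2)) ∂ν < ⊤) :
    ∫⁻ x in {x : ℝ | |x| ≤ 1}, ENNReal.ofReal (x ^ 2) ∂ν < ⊤ := by
  refine lt_of_le_of_lt ?_ hν_levy
  refine le_trans (setLIntegral_mono' measurableSet_abs_le_one fun x hx => ?_)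
    (setLIntegral_le_lintegral {x : ℝ | |x| ≤ 1} _)
  have hx : |x| ≤ 1 := hx
  rw [min_eq_right (by rw [← sq_abs]; exact pow_le_one₀ (abs_nonneg _) hx)]

theorem integrable_min_one_mul_sq
    (hν_levy : ∫⁻ x, ENNReal.ofReal (min 1 (x ^ 2)) ∂ν < ⊤) (r : ℝ) :
    Integrable (fun x => min 1 ((r * x) ^ 2)) ν := by
  have h1 : Integrable (fun x : ℝ => min 1 (x ^ 2)) ν :=
    (lintegral_ofReal_ne_top_iff_integrable (by fun_prop)
      (Filter.Eventually.of_forall fun x => le_min zero_le_one (sq_nonneg _))).1 hν_levy.ne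
  refine (h1.const_mul (1 + r ^ 2)).mono' (by fun_prop) (Filter.Eventually.of_forall fun x => ?_)
  rw [norm_of_nonneg (le_min zero_le_one (sq_nonneg _))]
  rcases le_total 1 (x ^ 2) with h | h
  · rw [min_eq_left h]
    exact (min_le_left _ _).trans (by nlinarith [sq_nonneg r])
  · rw [min_eq_right h]
    exact (min_le_right _ _).trans (by nlinarith [sq_nonneg x])

/-- A bound, monotone in `r`, for the compensated drift integrand over all `|c| ≤ 1`. -/
noncomputable def driftMajorant (r x : ℝ) : ℝ :=
  if |x| ≤ 1 then (if 1 < r * |x| then r * |x| else 0) else min 1 (r * |x|) + r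

theorem driftMajorant_nonneg {r x : ℝ} (hr : 0 ≤ r) : 0 ≤ driftMajorant r x := by
  have := mul_nonneg hr (abs_nonneg x)
  unfold driftMajorant
  split_ifs <;> positivity

theorem measurable_driftMajorant : Measurable (Function.uncurry driftMajorant) := by
  unfold driftMajorant Function.uncurry
  refine Measurable.ite (measurableSet_le (by fun_prop) (by fun_prop)) ?_ (by fun_prop)
  exact Measurable.ite (measurableSet_lt (by fun_prop) (by fun_prop)) (by fun_prop) (by fun_prop)

theorem abs_div_max_one_le (y : ℝ) : |y / (max 1 |y|)| ≤ min 1 |y| := by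
  have h : 0 < max 1 |y| := lt_max_of_lt_left one_pos
  rw [abs_div, abs_of_pos h]
  refine le_min ((div_le_one h).2 (le_max_right _ _)) (div_le_self (abs_nonneg _) (le_max_left _ _))

theorem abs_div_max_one_sub_self_le (y : ℝ) :
    |y / max 1 |y| - y| ≤ if 1 < |y| then |y| else 0 := by
  split_ifs with h
  · rw [max_eq_right h.le, show y / |y| - y = -(y * (1 - 1 / |y|)) by ring, abs_neg, abs_mul]
    have h1 : 0 ≤ 1 / |y| := by positivity
    have h2 : 1 / |y| ≤ 1 := (div_le_one (by linarith)).2 h.le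
    refine mul_le_of_le_one_right (abs_nonneg _) (abs_le.2 ⟨by linarith, by linarith⟩)
  · rw [max_eq_left (not_lt.1 h)]
    simp

theorem abs_truncation_sub_le_driftMajorant {τ : ℝ → ℝ} (hτ : ∀ x, τ x = x / max 1 |x|)
    {r c : ℝ} (hr : 0 ≤ r) (hc : |c| ≤ 1) (x : ℝ) :
    |τ (x * (c * r)) - c * r * τ x| ≤ driftMajorant r x := by
  have hcr : |c * r| ≤ r := by
    rw [abs_mul, abs_of_nonneg hr]
    exact mul_le_of_le_one_left hr hc
  have hxcr : |x * (c * r)| ≤ r * |x| := by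
    rw [abs_mul, mul_comm]
    exact mul_le_mul_of_nonneg_right hcr (abs_nonneg _)
  unfold driftMajorant
  split_ifs with h1 h2
  · have h3 := abs_div_max_one_sub_self_le (x * (c * r))
    rw [hτ, hτ, max_eq_left h1, div_one, mul_comm (c * r) x]
    split_ifs at h3 <;> linarith [abs_nonneg (x * (c * r))]
  · have h3 := abs_div_max_one_sub_self_le (x * (c * r))
    rw [hτ, hτ, max_eq_left h1, div_one, mul_comm (c * r) x]
    rwa [if_neg (by linarith)] at h3
  · have h3 := abs_div_max_one_le (x * (c * r))
    have h4 := (abs_div_max_one_le x).trans (min_le_left _ _)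
    rw [hτ, hτ]
    refine (abs_sub _ _).trans (add_le_add (h3.trans (min_le_min le_rfl hxcr)) ?_)
    rw [abs_mul]
    calc _ ≤ r * 1 := mul_le_mul hcr h4 (abs_nonneg _) hr
      _ = r := mul_one r

theorem ofReal_levyYoung_le {γ B : ℝ} {τ H Ψ : ℝ → ℝ}
    (hτ : ∀ x, τ x = x / max 1 |x|)
    (hH : ∀ r : ℝ, H r = |γ * r + ∫ x, (τ (x * r) - r * τ x) ∂ν|)
    (hΨ : ∀ r : ℝ, Ψ r =
      sSup {y : ℝ | ∃ c : ℝ, |c| ≤ 1 ∧ y = H (c * r)}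
        + B * r ^ 2 + ∫ x, min 1 ((r * x) ^ 2) ∂ν) {r : ℝ} (hr : 0 ≤ r) :
    ENNReal.ofReal (Ψ r) ≤ ENNReal.ofReal (|γ| * r) + ENNReal.ofReal (B * r ^ 2) +
      ∫⁻ x, ENNReal.ofReal (driftMajorant r x + min 1 ((r * x) ^ 2)) ∂ν := by
  have hsplit : ∫⁻ x, ENNReal.ofReal (driftMajorant r x + min 1 ((r * x) ^ 2)) ∂ν =
      (∫⁻ x, ENNReal.ofReal (driftMajorant r x) ∂ν) +
        ∫⁻ x, ENNReal.ofReal (min 1 ((r * x) ^ 2)) ∂ν := by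
    rw [← lintegral_add_right _ (by fun_prop)]
    exact lintegral_congr fun x => ENNReal.ofReal_add (driftMajorant_nonneg hr)
      (le_min zero_le_one (sq_nonneg _))
  have hK : ENNReal.ofReal (∫ x, min 1 ((r * x) ^ 2) ∂ν) ≤
      ∫⁻ x, ENNReal.ofReal (min 1 ((r * x) ^ 2)) ∂ν := by
    refine (Real.ofReal_le_enorm _).trans ((enorm_integral_le_lintegral_enorm _).trans ?_)
    exact le_of_eq (lintegral_congr fun x =>
      Real.enorm_of_nonneg (le_min zero_le_one (sq_nonneg _)))
  rw [hsplit]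
  by_cases hI : ∫⁻ x, ENNReal.ofReal (driftMajorant r x) ∂ν = ⊤
  · simp [hI]
  have hS : sSup {y : ℝ | ∃ c : ℝ, |c| ≤ 1 ∧ y = H (c * r)} ≤
      |γ| * r + (∫⁻ x, ENNReal.ofReal (driftMajorant r x) ∂ν).toReal := by
    refine Real.sSup_le ?_ (by positivity)
    rintro y ⟨c, hc, rfl⟩
    rw [hH]
    refine (abs_add_le _ _).trans (add_le_add ?_ ?_)
    · rw [abs_mul, abs_mul, abs_of_nonneg hr]
      exact mul_le_mul_of_nonneg_left (mul_le_of_le_one_left hr hc) (abs_nonneg _)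
    · rw [← Real.norm_eq_abs, ← toReal_enorm]
      refine ENNReal.toReal_mono hI ((enorm_integral_le_lintegral_enorm _).trans ?_)
      refine lintegral_mono fun x => ?_
      rw [Real.enorm_eq_ofReal_abs]
      exact ENNReal.ofReal_le_ofReal (abs_truncation_sub_le_driftMajorant hτ hr hc x)
  calc ENNReal.ofReal (Ψ r)
      ≤ ENNReal.ofReal (|γ| * r + (∫⁻ x, ENNReal.ofReal (driftMajorant r x) ∂ν).toReal
          + B * r ^ 2 + ∫ x, min 1 ((r * x) ^ 2) ∂ν) := by
        rw [hΨ]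
        exact ENNReal.ofReal_le_ofReal (by linarith)
    _ ≤ ENNReal.ofReal (|γ| * r) + (∫⁻ x, ENNReal.ofReal (driftMajorant r x) ∂ν)
          + ENNReal.ofReal (B * r ^ 2) + ENNReal.ofReal (∫ x, min 1 ((r * x) ^ 2) ∂ν) := by
        refine ENNReal.ofReal_add_le.trans ?_
        gcongr
        refine ENNReal.ofReal_add_le.trans ?_
        gcongr
        refine ENNReal.ofReal_add_le.trans ?_
        rw [ENNReal.ofReal_toReal hI]
    _ ≤ ENNReal.ofReal (|γ| * r) + (∫⁻ x, ENNReal.ofReal (driftMajorant r x) ∂ν)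
          + ENNReal.ofReal (B * r ^ 2) + ∫⁻ x, ENNReal.ofReal (min 1 ((r * x) ^ 2)) ∂ν := by
        gcongr
    _ = _ := by abel

theorem le_levyYoung {γ B : ℝ} {τ H Ψ : ℝ → ℝ} (hB : 0 ≤ B)
    (hH : ∀ r : ℝ, H r = |γ * r + ∫ x, (τ (x * r) - r * τ x) ∂ν|)
    (hΨ : ∀ r : ℝ, Ψ r =
      sSup {y : ℝ | ∃ c : ℝ, |c| ≤ 1 ∧ y = H (c * r)}
        + B * r ^ 2 + ∫ x, min 1 ((r * x) ^ 2) ∂ν) (r : ℝ) :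
    B * r ^ 2 ≤ Ψ r ∧ ∫ x, min 1 ((r * x) ^ 2) ∂ν ≤ Ψ r := by
  have h1 : 0 ≤ sSup {y : ℝ | ∃ c : ℝ, |c| ≤ 1 ∧ y = H (c * r)} := by
    refine Real.sSup_nonneg ?_
    rintro y ⟨c, -, rfl⟩
    rw [hH]
    exact abs_nonneg _
  have h2 : 0 ≤ ∫ x, min 1 ((r * x) ^ 2) ∂ν :=
    integral_nonneg fun x => le_min zero_le_one (sq_nonneg _)
  have h3 : 0 ≤ B * r ^ 2 := by positivity
  rw [hΨ]
  constructor <;> linarith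

theorem lintegral_jump_majorant_le_log (α : ℝ) (hα : -1 < α) :
    ∃ C : ℝ, 0 < C ∧ ∀ x : ℝ, 1 < |x| →
      ∫⁻ s in Ioi (0 : ℝ), ENNReal.ofReal
        (driftMajorant (gammaKernel α s) x + min 1 ((gammaKernel α s * x) ^ 2)) ≤
        ENNReal.ofReal (C * (1 + log |x|)) := by
  obtain ⟨C, hC, hbound⟩ := lintegral_min_one_gammaKernel_le_log α
  set M := ∫ s in Ioi (0 : ℝ), gammaKernel α s with hM
  have hM0 : 0 ≤ M := setIntegral_nonneg measurableSet_Ioi fun s hs => gammaKernel_nonneg hs.le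
  refine ⟨2 * C + M, by positivity, fun x hx => ?_⟩
  have hlog : 0 ≤ log |x| := log_nonneg hx.le
  have hgk : ∫⁻ s in Ioi (0 : ℝ), ENNReal.ofReal (gammaKernel α s) ≤ ENNReal.ofReal M :=
    setLIntegral_ofReal_le_of_integral_le measurableSet_Ioi (fun _ _ => le_rfl)
      (integrableOn_gammaKernel hα) (fun s hs => gammaKernel_nonneg hs.le) le_rfl
  calc ∫⁻ s in Ioi (0 : ℝ), ENNReal.ofReal
        (driftMajorant (gammaKernel α s) x + min 1 ((gammaKernel α s * x) ^ 2))
      ≤ ∫⁻ s in Ioi (0 : ℝ), (2 * ENNReal.ofReal (min 1 (gammaKernel α s * |x|))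
          + ENNReal.ofReal (gammaKernel α s)) := by
        refine setLIntegral_mono' measurableSet_Ioi fun s hs => ?_
        have hg : 0 ≤ gammaKernel α s := gammaKernel_nonneg (le_of_lt hs)
        have hz : 0 ≤ gammaKernel α s * |x| := by positivity
        have h1 : min 1 ((gammaKernel α s * x) ^ 2) ≤ min 1 (gammaKernel α s * |x|) := by
          rw [← sq_abs, abs_mul, abs_of_nonneg hg]
          rcases le_total 1 (gammaKernel α s * |x|) with h | h
          · rw [min_eq_left h]
            exact min_le_left _ _
          · rw [min_eq_right h]
            exact (min_le_right _ _).trans (by nlinarith)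
        have h2 : 0 ≤ min 1 (gammaKernel α s * |x|) := le_min zero_le_one hz
        rw [← ENNReal.ofReal_ofNat 2, ← ENNReal.ofReal_mul (by norm_num),
          ← ENNReal.ofReal_add (by positivity) hg, driftMajorant, if_neg hx.not_ge]
        exact ENNReal.ofReal_le_ofReal (by linarith)
    _ = 2 * (∫⁻ s in Ioi (0 : ℝ), ENNReal.ofReal (min 1 (gammaKernel α s * |x|)))
          + ∫⁻ s in Ioi (0 : ℝ), ENNReal.ofReal (gammaKernel α s) := by
        rw [lintegral_add_left (by fun_prop), lintegral_const_mul _ (by fun_prop)]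
    _ ≤ 2 * ENNReal.ofReal (C * (1 + log |x|)) + ENNReal.ofReal M := by
        gcongr
        exact hbound _ hx.le
    _ ≤ _ := by
        rw [← ENNReal.ofReal_ofNat 2, ← ENNReal.ofReal_mul (by norm_num),
          ← ENNReal.ofReal_add (by positivity) hM0]
        exact ENNReal.ofReal_le_ofReal (by nlinarith)

theorem lintegral_jump_majorant_le_sq {α : ℝ} (hα : -(1 / 2) < α) {x : ℝ} (hx : |x| ≤ 1) :
    ∫⁻ s in Ioi (0 : ℝ), ENNReal.ofReal
      (driftMajorant (gammaKernel α s) x + min 1 ((gammaKernel α s * x) ^ 2)) ≤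
      ENNReal.ofReal ((2 * ∫ s in Ioi (0 : ℝ), gammaKernel α s ^ 2) * x ^ 2) := by
  refine setLIntegral_ofReal_le_of_integral_le (g := fun s => 2 * (gammaKernel α s ^ 2) * x ^ 2)
    measurableSet_Ioi (fun s hs => ?_)
    (((integrableOn_gammaKernel_sq hα).const_mul _).mul_const _) (fun s _ => by positivity)
    (by rw [integral_mul_const, integral_const_mul])
  have h1 : driftMajorant (gammaKernel α s) x ≤ (gammaKernel α s * |x|) ^ 2 := by
    rw [driftMajorant, if_pos hx]
    split_ifs with h
    · nlinarith
    · positivity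
  have h2 := min_le_right 1 ((gammaKernel α s * x) ^ 2)
  rw [mul_pow] at h1 h2 ⊢
  rw [sq_abs] at h1
  linarith

theorem lintegral_jump_majorant_le_add {α : ℝ} (hα : -1 < α) (hα0 : α < 0) {x C : ℝ}
    (hx0 : x ≠ 0) (hx : |x| ≤ 1) (hC : 0 ≤ C)
    (hbound : ∫⁻ s in Ioi (0 : ℝ), ENNReal.ofReal (min 1 ((gammaKernel α s * |x|) ^ 2)) ≤
      ENNReal.ofReal C) :
    ∫⁻ s in Ioi (0 : ℝ), ENNReal.ofReal
      (driftMajorant (gammaKernel α s) x + min 1 ((gammaKernel α s * x) ^ 2)) ≤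
      ENNReal.ofReal (1 / (α + 1) * |x| ^ (-(1 / α)) + C) := by
  have hx' : 0 < |x| := abs_pos.2 hx0
  have hα1 : 0 < α + 1 := by linarith
  rw [ENNReal.ofReal_add (by positivity) hC]
  refine le_trans ?_ (add_le_add (lintegral_indicator_gammaKernel_le hα hα0 hx') hbound)
  rw [← lintegral_add_right _ (by fun_prop)]
  refine setLIntegral_mono' measurableSet_Ioi fun s _ => ?_
  rw [driftMajorant, if_pos hx, mul_pow, mul_pow, sq_abs]
  exact ENNReal.ofReal_add_le

theorem lintegral_jump_majorant_zero {α : ℝ} :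
    ∫⁻ s in Ioi (0 : ℝ), ENNReal.ofReal
      (driftMajorant (gammaKernel α s) 0 + min 1 ((gammaKernel α s * 0) ^ 2)) = 0 := by
  simp [driftMajorant]

theorem setLIntegral_lt_top_of_le_ofReal_const_mul {S : Set ℝ} (hS : MeasurableSet S)
    {F : ℝ → ℝ≥0∞} {w : ℝ → ℝ} {C : ℝ} (hC : 0 ≤ C)
    (hF : ∀ x ∈ S, F x ≤ ENNReal.ofReal (C * w x))
    (hw : ∫⁻ x in S, ENNReal.ofReal (w x) ∂ν < ⊤) : ∫⁻ x in S, F x ∂ν < ⊤ := by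
  refine (setLIntegral_mono' hS hF).trans_lt ?_
  simp_rw [ENNReal.ofReal_mul hC]
  rw [lintegral_const_mul' _ _ ENNReal.ofReal_ne_top]
  exact ENNReal.mul_lt_top ENNReal.ofReal_lt_top hw

theorem setLIntegral_ofReal_lt_top_of_const_mul_le {S : Set ℝ} (hS : MeasurableSet S)
    {F : ℝ → ℝ≥0∞} {w : ℝ → ℝ} {c : ℝ} (hc : 0 < c)
    (hF : ∀ x ∈ S, ENNReal.ofReal (c * w x) ≤ F x)
    (hFν : ∫⁻ x, F x ∂ν < ⊤) : ∫⁻ x in S, ENNReal.ofReal (w x) ∂ν < ⊤ := by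
  have h := ((setLIntegral_mono' hS hF).trans (setLIntegral_le_lintegral S F)).trans_lt hFν
  simp_rw [ENNReal.ofReal_mul hc.le] at h
  rw [lintegral_const_mul' _ _ ENNReal.ofReal_ne_top] at h
  exact ENNReal.lt_top_of_mul_ne_top_right h.ne (by simpa using hc)

theorem setLIntegral_jump_majorant_one_lt_abs_lt_top {α : ℝ} (hα : -1 < α)
    (hν_levy : ∫⁻ x, ENNReal.ofReal (min 1 (x ^ 2)) ∂ν < ⊤)
    (hlog : ∫⁻ x in {x : ℝ | 1 < |x|}, ENNReal.ofReal (log |x|) ∂ν < ⊤) :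
    ∫⁻ x in {x : ℝ | 1 < |x|}, (∫⁻ s in Ioi (0 : ℝ), ENNReal.ofReal
      (driftMajorant (gammaKernel α s) x + min 1 ((gammaKernel α s * x) ^ 2))) ∂ν < ⊤ := by
  obtain ⟨C, hC, hbound⟩ := lintegral_jump_majorant_le_log α hα
  refine setLIntegral_lt_top_of_le_ofReal_const_mul measurableSet_one_lt_abs hC.le hbound ?_
  calc ∫⁻ x in {x : ℝ | 1 < |x|}, ENNReal.ofReal (1 + log |x|) ∂ν
      ≤ ∫⁻ x in {x : ℝ | 1 < |x|}, (1 + ENNReal.ofReal (log |x|)) ∂ν :=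
        lintegral_mono fun x => ENNReal.ofReal_add_le.trans (by simp)
    _ = ν {x : ℝ | 1 < |x|} + ∫⁻ x in {x : ℝ | 1 < |x|}, ENNReal.ofReal (log |x|) ∂ν := by
        rw [lintegral_add_left measurable_const, setLIntegral_one]
    _ < ⊤ := ENNReal.add_lt_top.2 ⟨levy_measure_one_lt_abs_lt_top hν_levy, hlog⟩

theorem setLIntegral_jump_majorant_abs_le_one_lt_top {α B : ℝ} (hα : -1 < α)
    (hν_levy : ∫⁻ x, ENNReal.ofReal (min 1 (x ^ 2)) ∂ν < ⊤)
    (hsmall : α > -(1 / 2) ∨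
      (α = -(1 / 2) ∧ B = 0 ∧
        ∫⁻ x in {x : ℝ | |x| ≤ 1}, ENNReal.ofReal (x ^ 2 * abs (log |x|)) ∂ν < ⊤) ∨
      (α < -(1 / 2) ∧ B = 0 ∧
        ∫⁻ x in {x : ℝ | |x| ≤ 1}, ENNReal.ofReal (|x| ^ (-(1 / α))) ∂ν < ⊤)) :
    ∫⁻ x in {x : ℝ | |x| ≤ 1}, (∫⁻ s in Ioi (0 : ℝ), ENNReal.ofReal
      (driftMajorant (gammaKernel α s) x + min 1 ((gammaKernel α s * x) ^ 2))) ∂ν < ⊤ := by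
  rcases hsmall with h | ⟨rfl, -, h⟩ | ⟨hα', -, h⟩
  · refine setLIntegral_lt_top_of_le_ofReal_const_mul measurableSet_abs_le_one
      (C := 2 * ∫ s in Ioi (0 : ℝ), gammaKernel α s ^ 2) ?_
      (fun x hx => lintegral_jump_majorant_le_sq h hx) (levy_setLIntegral_sq_lt_top hν_levy)
    exact mul_nonneg zero_le_two (integral_nonneg fun _ => sq_nonneg _)
  · refine setLIntegral_lt_top_of_le_ofReal_const_mul measurableSet_abs_le_one
      (w := fun x => x ^ 2 + x ^ 2 * abs (log |x|)) (C := 4) (by norm_num) (fun x hx => ?_) ?_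
    · rcases eq_or_ne x 0 with rfl | hx0
      · rw [lintegral_jump_majorant_zero]
        exact zero_le
      · refine (lintegral_jump_majorant_le_add hα (by norm_num) hx0 hx (by positivity)
          (lintegral_min_one_gammaKernel_sq_le_log (abs_pos.2 hx0) hx)).trans
          (ENNReal.ofReal_le_ofReal ?_)
        have h2 : |x| ^ (-(1 / -(1 / 2)) : ℝ) = x ^ 2 := by
          rw [show (-(1 / -(1 / 2)) : ℝ) = (2 : ℕ) by norm_num, rpow_natCast, sq_abs]
        have h3 : 0 ≤ x ^ 2 * abs (log |x|) := by positivity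
        rw [h2, sq_abs, show (1 / (-(1 / 2) + 1) : ℝ) = 2 by norm_num]
        linarith
    · simp_rw [fun x : ℝ => ENNReal.ofReal_add (sq_nonneg x)
        (mul_nonneg (sq_nonneg x) (abs_nonneg (log |x|)))]
      rw [lintegral_add_left (by fun_prop)]
      exact ENNReal.add_lt_top.2 ⟨levy_setLIntegral_sq_lt_top hν_levy, h⟩
  · have hα1 : 0 < α + 1 := by linarith
    have hc : 0 < -(2 * α + 1) := by linarith
    refine setLIntegral_lt_top_of_le_ofReal_const_mul measurableSet_abs_le_one
      (C := 1 / (α + 1) + (1 + 1 / (-(2 * α + 1)))) (by positivity) (fun x hx => ?_) h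
    rcases eq_or_ne x 0 with rfl | hx0
    · rw [lintegral_jump_majorant_zero]
      exact zero_le
    · rw [add_mul]
      exact lintegral_jump_majorant_le_add hα (by linarith) hx0 hx (by positivity)
        (lintegral_min_one_gammaKernel_sq_le_rpow hα' (abs_pos.2 hx0))

theorem setLIntegral_log_lt_top {α : ℝ} (hα : -1 < α)
    (hν_levy : ∫⁻ x, ENNReal.ofReal (min 1 (x ^ 2)) ∂ν < ⊤)
    (hG : ∫⁻ x, (∫⁻ s in Ioi (0 : ℝ),
      ENNReal.ofReal (min 1 ((gammaKernel α s * |x|) ^ 2))) ∂ν < ⊤) :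
    ∫⁻ x in {x : ℝ | 1 < |x|}, ENNReal.ofReal (log |x|) ∂ν < ⊤ := by
  have h1 : ∫⁻ x in {x : ℝ | 1 < |x|}, ENNReal.ofReal (log |x| - 2) ∂ν < ⊤ := by
    refine setLIntegral_ofReal_lt_top_of_const_mul_le measurableSet_one_lt_abs
      (c := 1 / 2) (by norm_num) (fun x hx => ?_) hG
    have hx : 1 < |x| := hx
    rw [show 1 / 2 * (log |x| - 2) = log |x| / 2 - 1 by ring]
    exact log_le_lintegral_min_one_gammaKernel_sq hα hx.le
  calc ∫⁻ x in {x : ℝ | 1 < |x|}, ENNReal.ofReal (log |x|) ∂ν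
      ≤ ∫⁻ x in {x : ℝ | 1 < |x|}, (2 + ENNReal.ofReal (log |x| - 2)) ∂ν := by
        refine lintegral_mono fun x => ?_
        rw [← ENNReal.ofReal_ofNat 2]
        refine le_trans (ENNReal.ofReal_le_ofReal ?_) ENNReal.ofReal_add_le
        linarith
    _ = 2 * ν {x : ℝ | 1 < |x|} + ∫⁻ x in {x : ℝ | 1 < |x|}, ENNReal.ofReal (log |x| - 2) ∂ν := by
        rw [lintegral_add_left measurable_const, setLIntegral_const]
    _ < ⊤ := ENNReal.add_lt_top.2
        ⟨ENNReal.mul_lt_top (by simp) (levy_measure_one_lt_abs_lt_top hν_levy), h1⟩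

end LevyMeasure

/-- integrability of the gamma kernel, Example 3.2 of the paper.
For a Lévy triplet `(γ, B, ν)` on `ℝ` with associated Young function `Ψ`, the gamma
kernel `φ_α(s) = e^{-s} s^α 𝟙_{s>0}` satisfies `∫ Ψ(φ_α(s)) ds < ∞` iff
`∫_{|x|>1} log|x| ν(dx) < ∞` and one of (a) `α > -1/2`, (b) `α = -1/2`, `B = 0`,
`∫_{|x|≤1} x²|log|x|| ν(dx) < ∞`, (c) `α ∈ (-1,-1/2)`, `B = 0`,
`∫_{|x|≤1} |x|^{-1/α} ν(dx) < ∞`. -/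
theorem gamma_kernel_in_levy_orlicz_iff
    (γ : ℝ) (B : ℝ) (hB : 0 ≤ B)
    (ν : Measure ℝ)
    (hν_zero : ν {0} = 0)
    (hν_levy : ∫⁻ x, ENNReal.ofReal (min 1 (x ^ 2)) ∂ν < ⊤)
    (α : ℝ) (hα : -1 < α)
    (τ : ℝ → ℝ) (hτ : ∀ x, τ x = x / max 1 |x|)
    (H : ℝ → ℝ)
    (hH : ∀ r : ℝ, H r = |γ * r + ∫ x, (τ (x * r) - r * τ x) ∂ν|)
    (Ψ : ℝ → ℝ)
    (hΨ : ∀ r : ℝ, Ψ r =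
      sSup {y : ℝ | ∃ c : ℝ, |c| ≤ 1 ∧ y = H (c * r)}
        + B * r ^ 2 + ∫ x, min 1 ((r * x) ^ 2) ∂ν)
    (φ : ℝ → ℝ) (hφ : ∀ s : ℝ, φ s = if 0 < s then Real.exp (-s) * s ^ α else 0) :
    (∫⁻ s, ENNReal.ofReal (Ψ (φ s)) < ⊤) ↔
      ((∫⁻ x in {x : ℝ | 1 < |x|}, ENNReal.ofReal (Real.log |x|) ∂ν < ⊤) ∧
        (α > -(1 / 2) ∨
          (α = -(1 / 2) ∧ B = 0 ∧
            ∫⁻ x in {x : ℝ | |x| ≤ 1},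
              ENNReal.ofReal (x ^ 2 * abs (Real.log |x|)) ∂ν < ⊤) ∨
          (α < -(1 / 2) ∧ B = 0 ∧
            ∫⁻ x in {x : ℝ | |x| ≤ 1},
              ENNReal.ofReal (|x| ^ (-(1 / α))) ∂ν < ⊤))) := by
  have := sFinite_of_levy hν_zero hν_levy
  have hφ_pos : ∀ s ∈ Ioi (0 : ℝ), φ s = gammaKernel α s := fun s hs => by
    rw [hφ, if_pos (mem_Ioi.1 hs), gammaKernel]
  have hΨ0 : ENNReal.ofReal (Ψ 0) = 0 := by
    refine le_antisymm ((ofReal_levyYoung_le hτ hH hΨ le_rfl).trans ?_) zero_le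
    have h0 : ∀ x, driftMajorant 0 x = 0 := fun x => by
      simp [driftMajorant, not_lt.2 (zero_le_one (α := ℝ))]
    simp [h0]
  have hrestrict : ∫⁻ s, ENNReal.ofReal (Ψ (φ s)) =
      ∫⁻ s in Ioi (0 : ℝ), ENNReal.ofReal (Ψ (gammaKernel α s)) := by
    rw [← lintegral_indicator measurableSet_Ioi]
    refine lintegral_congr fun s => ?_
    by_cases hs : s ∈ Ioi (0 : ℝ)
    · rw [indicator_of_mem hs, hφ_pos s hs]
    · rw [indicator_of_notMem hs, hφ, if_neg (mt mem_Ioi.2 hs), hΨ0]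
  rw [hrestrict]
  constructor
  · intro h
    have hG : ∫⁻ x, (∫⁻ s in Ioi (0 : ℝ),
        ENNReal.ofReal (min 1 ((gammaKernel α s * |x|) ^ 2))) ∂ν < ⊤ := by
      simp_rw [mul_pow, sq_abs, ← mul_pow]
      rw [← lintegral_lintegral_swap (by unfold Function.uncurry; fun_prop)]
      refine lt_of_le_of_lt (lintegral_mono fun s => ?_) h
      rw [← ofReal_integral_eq_lintegral_ofReal (integrable_min_one_mul_sq hν_levy _)
        (Filter.Eventually.of_forall fun x => le_min zero_le_one (sq_nonneg _))]
      exact ENNReal.ofReal_le_ofReal (le_levyYoung hB hH hΨ _).2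
    have hB0 : α ≤ -(1 / 2) → B = 0 := by
      intro hα2
      by_contra hne
      have hBpos : 0 < B := lt_of_le_of_ne hB (Ne.symm hne)
      have h1 : ∫⁻ s in Ioi (0 : ℝ), ENNReal.ofReal (B * gammaKernel α s ^ 2) < ⊤ :=
        lt_of_le_of_lt (lintegral_mono fun s =>
          ENNReal.ofReal_le_ofReal (le_levyYoung hB hH hΨ _).1) h
      simp_rw [ENNReal.ofReal_mul hB] at h1
      rw [lintegral_const_mul' _ _ ENNReal.ofReal_ne_top, lintegral_gammaKernel_sq_eq_top hα2,
        ENNReal.mul_top (by simpa using hBpos)] at h1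
      exact lt_irrefl _ h1
    refine ⟨setLIntegral_log_lt_top hα hν_levy hG, ?_⟩
    rcases lt_trichotomy α (-(1 / 2)) with hα2 | rfl | hα2
    · refine Or.inr (Or.inr ⟨hα2, hB0 hα2.le, ?_⟩)
      refine setLIntegral_ofReal_lt_top_of_const_mul_le measurableSet_abs_le_one
        (c := Real.exp (-1) ^ 2) (by positivity) (fun x hx => ?_) hG
      rcases eq_or_ne x 0 with rfl | hx0
      · have hα0 : -(1 / α) ≠ 0 := neg_ne_zero.2 (one_div_ne_zero (by linarith))
        rw [abs_zero, zero_rpow hα0]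
        simp
      · exact rpow_le_lintegral_min_one_gammaKernel_sq (by linarith) (abs_pos.2 hx0) hx
    · refine Or.inr (Or.inl ⟨rfl, hB0 le_rfl, ?_⟩)
      refine setLIntegral_ofReal_lt_top_of_const_mul_le measurableSet_abs_le_one
        (c := Real.exp (-1) ^ 2) (by positivity) (fun x hx => ?_) hG
      rcases eq_or_ne x 0 with rfl | hx0
      · simp
      · rw [← sq_abs x]
        exact log_le_lintegral_min_one_gammaKernel_neg_half_sq (abs_pos.2 hx0) hx
    · exact Or.inl hα2
  · rintro ⟨hlog, hsmall⟩
    have hJ : ∫⁻ s in Ioi (0 : ℝ), (∫⁻ x, ENNReal.ofReal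
        (driftMajorant (gammaKernel α s) x + min 1 ((gammaKernel α s * x) ^ 2)) ∂ν) < ⊤ := by
      rw [lintegral_lintegral_swap, ← lintegral_add_compl _ measurableSet_abs_le_one]
      · refine ENNReal.add_lt_top.2
          ⟨setLIntegral_jump_majorant_abs_le_one_lt_top hα hν_levy hsmall, ?_⟩
        rw [show {x : ℝ | |x| ≤ 1}ᶜ = {x : ℝ | 1 < |x|} by ext; simp]
        exact setLIntegral_jump_majorant_one_lt_abs_lt_top hα hν_levy hlog
      · have hm : Measurable fun p : ℝ × ℝ => driftMajorant (gammaKernel α p.1) p.2 :=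
          measurable_driftMajorant.comp (f := fun p : ℝ × ℝ => (gammaKernel α p.1, p.2))
            (by fun_prop)
        unfold Function.uncurry
        fun_prop
    have hdrift : ∫⁻ s in Ioi (0 : ℝ), ENNReal.ofReal (|γ| * gammaKernel α s) < ⊤ :=
      ((integrableOn_gammaKernel hα).const_mul _).lintegral_lt_top
    have hgauss : ∫⁻ s in Ioi (0 : ℝ), ENNReal.ofReal (B * gammaKernel α s ^ 2) < ⊤ := by
      rcases hsmall with h | ⟨-, rfl, -⟩ | ⟨-, rfl, -⟩
      · exact ((integrableOn_gammaKernel_sq h).const_mul _).lintegral_lt_top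
      · simp
      · simp
    refine (setLIntegral_mono' measurableSet_Ioi fun s hs =>
      ofReal_levyYoung_le hτ hH hΨ (gammaKernel_nonneg (le_of_lt hs))).trans_lt ?_
    rw [lintegral_add_left (by fun_prop), lintegral_add_left (by fun_prop)]
    exact ENNReal.add_lt_top.2 ⟨ENNReal.add_lt_top.2 ⟨hdrift, hgauss⟩, hJ⟩
end

section
/- Let ν be a Lévy measure on ℝ (i.e. ν({0}) = 0 and ∫_ℝ (1 ∧ x²) ν(dx) < ∞) satisfying ∫_{|x|>1} |x| ν(dx) < ∞. Then ∫_ℝ ∫_0^∞ ( |x e^{−s}| ∧ |x e^{−s}|² ) ds ν(dx) < ∞. -/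
open MeasureTheory Set Real
open scoped ENNReal

theorem lintegral_exp_neg_Ioi_zero :
    ∫⁻ s in Set.Ioi (0 : ℝ), ENNReal.ofReal (Real.exp (-s)) = 1 := by
  rw [← ofReal_integral_eq_lintegral_ofReal (integrableOn_exp_neg_Ioi 0)
    (ae_of_all _ fun s => (Real.exp_pos _).le), integral_exp_neg_Ioi_zero, ENNReal.ofReal_one]

theorem min_abs_mul_sq_le {x t : ℝ} (ht₀ : 0 ≤ t) (ht₁ : t ≤ 1) :
    min |x * t| (|x * t| ^ 2) ≤ min |x| (x ^ 2) * t := by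
  rw [min_mul_of_nonneg _ _ ht₀, abs_mul, abs_of_nonneg ht₀, mul_pow, sq_abs]
  gcongr
  nlinarith

theorem lintegral_min_abs_mul_exp_neg_le (x : ℝ) :
    ∫⁻ s in Set.Ioi (0 : ℝ),
        ENNReal.ofReal (min |x * Real.exp (-s)| (|x * Real.exp (-s)| ^ 2)) ≤
      ENNReal.ofReal (min |x| (x ^ 2)) := by
  calc
    _ ≤ ∫⁻ s in Set.Ioi (0 : ℝ),
        ENNReal.ofReal (min |x| (x ^ 2)) * ENNReal.ofReal (Real.exp (-s)) := by
      refine setLIntegral_mono (by fun_prop) fun s hs => ?_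
      rw [← ENNReal.ofReal_mul (by positivity)]
      exact ENNReal.ofReal_le_ofReal <| min_abs_mul_sq_le (Real.exp_pos _).le
        (Real.exp_le_one_iff.2 (neg_nonpos.2 (le_of_lt hs)))
    _ = _ := by
      rw [lintegral_const_mul _ (by fun_prop), lintegral_exp_neg_Ioi_zero, mul_one]

theorem ofReal_min_abs_sq_le (x : ℝ) :
    ENNReal.ofReal (min |x| (x ^ 2)) ≤ ENNReal.ofReal (min 1 (x ^ 2)) +
      {x : ℝ | 1 < |x|}.indicator (fun x => ENNReal.ofReal |x|) x := by
  by_cases hx : 1 < |x|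
  · rw [Set.indicator_of_mem (by exact hx)]
    exact (ENNReal.ofReal_le_ofReal (min_le_left _ _)).trans le_add_self
  · exact (ENNReal.ofReal_le_ofReal (min_le_min_right _ (not_lt.1 hx))).trans le_self_add

/-- key computation in the proof of Theorem 4.2.
If the Lévy measure `ν` satisfies `∫_{|x|>1} |x| ν(dx) < ∞`, then
`∫_ℝ ∫_0^∞ (|x e^{-s}| ∧ |x e^{-s}|²) ds ν(dx) < ∞`. -/
theorem exponential_kernel_first_moment_integrability
    (ν : Measure ℝ)
    (hν_zero : ν {0} = 0)
    (hν_levy : ∫⁻ x, ENNReal.ofReal (min 1 (x ^ 2)) ∂ν < ⊤)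
    (hν_moment : ∫⁻ x in {x : ℝ | 1 < |x|}, ENNReal.ofReal |x| ∂ν < ⊤) :
    ∫⁻ x, (∫⁻ s in Set.Ioi (0 : ℝ),
        ENNReal.ofReal (min |x * Real.exp (-s)| (|x * Real.exp (-s)| ^ 2))) ∂ν
      < ⊤ := by
  have hmeas : MeasurableSet {x : ℝ | 1 < |x|} :=
    measurableSet_lt measurable_const measurable_id.abs
  calc
    _ ≤ ∫⁻ x, (ENNReal.ofReal (min 1 (x ^ 2)) +
        {x : ℝ | 1 < |x|}.indicator (fun x => ENNReal.ofReal |x|) x) ∂ν :=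
      lintegral_mono fun x =>
        (lintegral_min_abs_mul_exp_neg_le x).trans (ofReal_min_abs_sq_le x)
    _ = ∫⁻ x, ENNReal.ofReal (min 1 (x ^ 2)) ∂ν +
        ∫⁻ x in {x : ℝ | 1 < |x|}, ENNReal.ofReal |x| ∂ν := by
      rw [lintegral_add_left (by fun_prop), lintegral_indicator hmeas]
    _ < ⊤ := ENNReal.add_lt_top.2 ⟨hν_levy, hν_moment⟩
end

section
/- Let α ∈ (−1, 0) with α ≠ −1/2, and let ν be a Lévy measure on ℝ (i.e. ν({0}) = 0 and ∫_ℝ (1 ∧ x²) ν(dx) < ∞) satisfying ∫_{|x|>1} |x| ν(dx) < ∞ and ∫_{|x|≤1} |x|^{−1/α} ν(dx) < ∞. Then ∫_ℝ ∫_0^1 ( |x s^α| ∧ |x s^α|² ) ds ν(dx) = (1/(α+1)) ∫_ℝ ( |x|^{−1/α} ∧ |x| ) ν(dx) + (1/(2α+1)) ∫_{|x|≤1} ( x² − |x|^{−1/α} ) ν(dx), and in particular this quantity is finite. -/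
open MeasureTheory Set Real
open scoped ENNReal

lemma min_self_sq_of_one_le {y : ℝ} (hy : 1 ≤ y) : min y (y ^ 2) = y :=
  min_eq_left (by nlinarith)

lemma min_self_sq_of_le_one {y : ℝ} (hy₀ : 0 ≤ y) (hy : y ≤ 1) : min y (y ^ 2) = y ^ 2 :=
  min_eq_right (by nlinarith)

lemma abs_mul_rpow {s : ℝ} (hs : 0 ≤ s) (x α : ℝ) : |x * s ^ α| = |x| * s ^ α := by
  rw [abs_mul, abs_of_nonneg (rpow_nonneg hs α)]

/-- The inner integral for a large jump: the linear part of the minimum is active on `(0, 1]`. -/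
lemma integral_min_rpow_of_one_le {α x : ℝ} (hα₁ : -1 < α) (hα₂ : α < 0) (hx : 1 ≤ |x|) :
    ∫ s in (0 : ℝ)..1, min |x * s ^ α| (|x * s ^ α| ^ 2) = |x| / (α + 1) := by
  have hcongr : ∫ s in (0 : ℝ)..1, min |x * s ^ α| (|x * s ^ α| ^ 2)
      = ∫ s in (0 : ℝ)..1, |x| * s ^ α := by
    refine intervalIntegral.integral_congr_uIoo fun s hs => ?_
    rw [uIoo_of_le zero_le_one] at hs
    have h1 : 1 ≤ s ^ α := one_le_rpow_of_pos_of_le_one_of_nonpos hs.1 hs.2.le hα₂.le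
    simp only [abs_mul_rpow hs.1.le]
    exact min_self_sq_of_one_le (by nlinarith)
  rw [hcongr, intervalIntegral.integral_const_mul, integral_rpow (Or.inl hα₁), one_rpow,
    zero_rpow (by linarith)]
  ring

/-- The inner integral for a small jump: the minimum switches from its linear to its quadratic
part at `s = |x| ^ (-(1 / α))`. -/
lemma integral_min_rpow_of_le_one {α x : ℝ} (hα₁ : -1 < α) (hα₂ : α < 0)
    (hα₃ : α ≠ -(1 / 2)) (hx : |x| ≤ 1) :
    ∫ s in (0 : ℝ)..1, min |x * s ^ α| (|x * s ^ α| ^ 2)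
      = 1 / (α + 1) * |x| ^ (-(1 / α))
        + 1 / (2 * α + 1) * (x ^ 2 - |x| ^ (-(1 / α))) := by
  have hp : 0 < -(1 / α) := by
    have := one_div_neg.2 hα₂
    linarith
  rcases eq_or_ne x 0 with rfl | hx0
  · simp [zero_rpow (by simpa using hp.ne' : -α⁻¹ ≠ 0)]
  have ha : 0 < |x| := abs_pos.2 hx0
  rw [← sq_abs x]
  obtain ⟨a, ha_def⟩ : ∃ a, a = |x| := ⟨_, rfl⟩
  rw [← ha_def] at ha hx ⊢
  obtain ⟨t, ht_def⟩ : ∃ t, t = a ^ (-(1 / α)) := ⟨_, rfl⟩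
  rw [← ht_def]
  have ht : 0 < t := ht_def ▸ rpow_pos_of_pos ha _
  have ht1 : t ≤ 1 := ht_def ▸ rpow_le_one ha.le hx hp.le
  have htα : t ^ α = a⁻¹ := by
    rw [ht_def, ← rpow_mul ha.le, show -(1 / α) * α = -1 by field_simp [hα₂.ne], rpow_neg_one]
  have hcongr₁ : EqOn (fun s : ℝ => a * s ^ α)
      (fun s => min |x * s ^ α| (|x * s ^ α| ^ 2)) (uIoc 0 t) := by
    intro s hs
    rw [uIoc_of_le ht.le] at hs
    have h1 : a⁻¹ ≤ s ^ α := htα ▸ rpow_le_rpow_of_nonpos hs.1 hs.2 hα₂.le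
    have h2 : 1 ≤ a * s ^ α := by
      rw [← mul_inv_cancel₀ ha.ne']
      gcongr
    simp only [abs_mul_rpow hs.1.le, ← ha_def]
    exact (min_self_sq_of_one_le h2).symm
  have hcongr₂ : EqOn (fun s : ℝ => a ^ 2 * s ^ (2 * α))
      (fun s => min |x * s ^ α| (|x * s ^ α| ^ 2)) (uIoc t 1) := by
    intro s hs
    rw [uIoc_of_le ht1] at hs
    have hs0 : 0 < s := ht.trans hs.1
    have h1 : s ^ α ≤ a⁻¹ := htα ▸ rpow_le_rpow_of_nonpos ht hs.1.le hα₂.le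
    have h2 : a * s ^ α ≤ 1 := by
      rw [← mul_inv_cancel₀ ha.ne']
      gcongr
    simp only [abs_mul_rpow hs0.le]
    rw [← ha_def, min_self_sq_of_le_one (by positivity) h2, mul_pow, mul_comm 2 α,
      rpow_mul hs0.le, rpow_two]
  have h0 : (0 : ℝ) ∉ uIcc t 1 := by
    rw [uIcc_of_le ht1]
    exact fun h => ht.not_ge h.1
  have hint₁ : IntervalIntegrable (fun s : ℝ => a * s ^ α) volume 0 t :=
    (intervalIntegral.intervalIntegrable_rpow' hα₁).const_mul a
  have hint₂ : IntervalIntegrable (fun s : ℝ => a ^ 2 * s ^ (2 * α)) volume t 1 :=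
    (intervalIntegral.intervalIntegrable_rpow (Or.inr h0)).const_mul _
  have hα₄ : 2 * α + 1 ≠ 0 := fun h => hα₃ (by linarith)
  have hα₅ : α + 1 ≠ 0 := by linarith
  rw [← intervalIntegral.integral_add_adjacent_intervals (hint₁.congr hcongr₁)
      (hint₂.congr hcongr₂),
    ← intervalIntegral.integral_congr_ae (ae_of_all _ hcongr₁),
    ← intervalIntegral.integral_congr_ae (ae_of_all _ hcongr₂),
    intervalIntegral.integral_const_mul, intervalIntegral.integral_const_mul,
    integral_rpow (Or.inl hα₁),
    integral_rpow (Or.inr ⟨fun h => hα₄ (by linarith), h0⟩), one_rpow, zero_rpow hα₅,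
    rpow_add ht, rpow_one, htα, rpow_add ht, mul_comm 2 α, rpow_mul ht.le, htα, rpow_two,
    rpow_one]
  rw [mul_comm 2 α] at hα₄
  field_simp
  ring

/-- second key computation in the proof of Theorem 4.2.
For `α ∈ (-1,0)`, `α ≠ -1/2`, and a Lévy measure `ν` with `∫_{|x|>1}|x| ν(dx) < ∞`
and `∫_{|x|≤1} |x|^{-1/α} ν(dx) < ∞`, one has
`∫_ℝ ∫_0^1 (|x s^α| ∧ |x s^α|²) ds ν(dx)
  = (α+1)⁻¹ ∫ (|x|^{-1/α} ∧ |x|) ν(dx) + (2α+1)⁻¹ ∫_{|x|≤1} (x² - |x|^{-1/α}) ν(dx)`,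
and in particular this quantity is finite. -/
theorem gamma_kernel_singular_part_computation
    (α : ℝ) (hα₁ : -1 < α) (hα₂ : α < 0) (hα₃ : α ≠ -(1 / 2))
    (ν : Measure ℝ)
    (hν_zero : ν {0} = 0)
    (hν_levy : ∫⁻ x, ENNReal.ofReal (min 1 (x ^ 2)) ∂ν < ⊤)
    (hν_moment : ∫⁻ x in {x : ℝ | 1 < |x|}, ENNReal.ofReal |x| ∂ν < ⊤)
    (hν_small : ∫⁻ x in {x : ℝ | |x| ≤ 1}, ENNReal.ofReal (|x| ^ (-(1 / α))) ∂ν < ⊤) :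
    Integrable
        (fun x : ℝ => ∫ s in (0 : ℝ)..1, min |x * s ^ α| (|x * s ^ α| ^ 2)) ν ∧
    (∫ x, (∫ s in (0 : ℝ)..1, min |x * s ^ α| (|x * s ^ α| ^ 2)) ∂ν)
      = (1 / (α + 1)) * (∫ x, min (|x| ^ (-(1 / α))) |x| ∂ν)
        + (1 / (2 * α + 1)) *
            (∫ x in {x : ℝ | |x| ≤ 1}, (x ^ 2 - |x| ^ (-(1 / α))) ∂ν) := by
  have hp : 1 ≤ -(1 / α) := by
    rw [← one_div_neg_eq_neg_one_div, le_div_iff₀ (by linarith)]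
    linarith
  have hmeas : MeasurableSet {x : ℝ | |x| ≤ 1} := measurableSet_le (by fun_prop) (by fun_prop)
  have hcompl : {x : ℝ | |x| ≤ 1}ᶜ = {x : ℝ | 1 < |x|} := by
    ext x
    simp
  have hpow : IntegrableOn (fun x : ℝ => |x| ^ (-(1 / α))) {x : ℝ | |x| ≤ 1} ν :=
    (lintegral_ofReal_ne_top_iff_integrable (measurable_id.abs.pow_const _).aestronglyMeasurable
      (ae_of_all _ fun x => by positivity)).1 hν_small.ne
  have habs : IntegrableOn (fun x : ℝ => |x|) {x : ℝ | 1 < |x|} ν :=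
    (lintegral_ofReal_ne_top_iff_integrable (by fun_prop)
      (ae_of_all _ fun x => by positivity)).1 hν_moment.ne
  have hlevy : Integrable (fun x : ℝ => min 1 (x ^ 2)) ν :=
    (lintegral_ofReal_ne_top_iff_integrable (by fun_prop)
      (ae_of_all _ fun x => by positivity)).1 hν_levy.ne
  have hsq : IntegrableOn (fun x : ℝ => x ^ 2) {x : ℝ | |x| ≤ 1} ν :=
    hlevy.integrableOn.congr_fun
      (fun x hx => min_eq_right ((sq_le_one_iff_abs_le_one x).2 hx)) hmeas
  have hmin_small : ∀ x : ℝ, |x| ≤ 1 → min (|x| ^ (-(1 / α))) |x| = |x| ^ (-(1 / α)) :=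
    fun x hx => min_eq_left (rpow_le_self_of_le_one (abs_nonneg x) hx hp)
  have hmin_large : ∀ x : ℝ, 1 < |x| → min (|x| ^ (-(1 / α))) |x| = |x| :=
    fun x hx => min_eq_right (self_le_rpow_of_one_le hx.le hp)
  have hmin : Integrable (fun x : ℝ => min (|x| ^ (-(1 / α))) |x|) ν := by
    rw [← integrableOn_univ, ← union_compl_self {x : ℝ | |x| ≤ 1}, hcompl]
    exact (hpow.congr_fun (fun x hx => (hmin_small x hx).symm) hmeas).union
      (habs.congr_fun (fun x hx => (hmin_large x hx).symm) (hcompl ▸ hmeas.compl))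
  have hdiff : Integrable ({x : ℝ | |x| ≤ 1}.indicator
      fun x => x ^ 2 - |x| ^ (-(1 / α))) ν := (hsq.sub hpow).integrable_indicator hmeas
  have hinner : (fun x : ℝ => ∫ s in (0 : ℝ)..1, min |x * s ^ α| (|x * s ^ α| ^ 2))
      = fun x => 1 / (α + 1) * min (|x| ^ (-(1 / α))) |x| + 1 / (2 * α + 1) *
        {x : ℝ | |x| ≤ 1}.indicator (fun x => x ^ 2 - |x| ^ (-(1 / α))) x := by
    funext x
    rcases le_or_gt |x| 1 with hx | hx
    · rw [integral_min_rpow_of_le_one hα₁ hα₂ hα₃ hx, hmin_small x hx,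
        indicator_of_mem (s := {x : ℝ | |x| ≤ 1}) hx]
    · rw [integral_min_rpow_of_one_le hα₁ hα₂ hx.le, hmin_large x hx,
        indicator_of_notMem (s := {x : ℝ | |x| ≤ 1}) hx.not_ge]
      ring
  rw [hinner]
  refine ⟨(hmin.const_mul _).add (hdiff.const_mul _), ?_⟩
  rw [integral_add (hmin.const_mul _) (hdiff.const_mul _), integral_const_mul,
    integral_const_mul, integral_indicator hmeas]
end
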